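/- arXiv:1702.05973 — 2 statements merged into one kernel-verified Lean document; each statement's English description precedes it below -/
import Mathlib

section
/- For t > 0 and x, y ∈ ℝ⁴, let k_t(x,y) = (4πt)^{−2} exp(−‖x−y‖²/(4t)) be the scalar heat kernel on ℝ⁴. Fix L > 0, indices i, j ∈ {1,2,3,4}, and a smooth compactly supported function φ : ℝ⁴ × ℝ⁴ → ℝ. For 0 < ε < L define I(ε) = ∫_{ℝ⁴×ℝ⁴} ∫_{[ε,L]²} φ(x,y) · t₁ t₂ · (∂²k_{t₁}/∂x^i∂t₁)(x,y) (∂k_{t₂}/∂x^j)(x,y) dt₁ dt₂ dx dy. Then I(ε) − (δ_{ij}/(64π²)) ( ∫_{ℝ⁴} φ(x,x) dx ) · log ε converges to a finite limit as ε → 0⁺; that is, the logarithmic singular part of I(ε) equals (1/(16π²)) · δ_{ij} · (1/4) · ∫_{ℝ⁴} φ(x,x) dx times log ε. -/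
open MeasureTheory Filter Topology

/-- The spatial derivative `∂k_t/∂x^j` of the scalar heat kernel
`k_t(x,y) = (4πt)⁻² exp(-‖x-y‖²/(4t))` on `ℝ⁴`. -/
noncomputable def heatKernelDx (j : Fin 4) (t : ℝ)
    (x y : EuclideanSpace ℝ (Fin 4)) : ℝ :=
  -(1 / (4 * Real.pi) ^ 2) * ((x j - y j) / (2 * t ^ 3)) *
    Real.exp (-‖x - y‖ ^ 2 / (4 * t))

/-- The mixed derivative `∂²k_t/∂x^i∂t` of the scalar heat kernel on `ℝ⁴`. -/
noncomputable def heatKernelDxt (i : Fin 4) (t : ℝ)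
    (x y : EuclideanSpace ℝ (Fin 4)) : ℝ :=
  (1 / (4 * Real.pi) ^ 2) *
    ((3 / 2) * (x i - y i) / t ^ 4 - (1 / 8) * (x i - y i) * ‖x - y‖ ^ 2 / t ^ 5) *
    Real.exp (-‖x - y‖ ^ 2 / (4 * t))

/-- A continuous profile equal to `1` at the origin to first order and vanishing at infinity. -/
structure IsCutoff (f : ℝ → ℝ) (C : ℝ) : Prop where
  continuous : Continuous f
  abs_le : ∀ w, 0 ≤ w → |f w| ≤ C
  abs_sub_one_le : ∀ w, 0 ≤ w → |f w - 1| ≤ C * w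
  mul_abs_le : ∀ w, 0 ≤ w → w * |f w| ≤ C

/-- The profile whose rescaling is a primitive of the `t₁`-integrand. -/
noncomputable def profileXT (w : ℝ) : ℝ := (1 + w - w ^ 2) * Real.exp (-w)

theorem isCutoff_exp_neg : IsCutoff (fun w => Real.exp (-w)) 9 := by
  refine ⟨by fun_prop, fun w hw => ?_, fun w hw => ?_, fun w hw => ?_⟩
  · rw [abs_of_pos (Real.exp_pos _)]
    linarith [Real.exp_le_one_iff.2 (neg_nonpos.2 hw)]
  · rw [abs_of_nonpos (by linarith [Real.exp_le_one_iff.2 (neg_nonpos.2 hw)])]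
    linarith [Real.add_one_le_exp (-w)]
  · rw [abs_of_pos (Real.exp_pos _), Real.exp_neg, ← div_eq_mul_inv,
      div_le_iff₀ (Real.exp_pos _)]
    linarith [Real.add_one_le_exp w]

theorem isCutoff_profileXT : IsCutoff profileXT 9 := by
  have h1 (w : ℝ) : |1 + w - w ^ 2| ≤ 1 + |w| + w ^ 2 := by
    calc |1 + w - w ^ 2| ≤ |1 + w| + |w ^ 2| := abs_sub _ _
      _ ≤ 1 + |w| + w ^ 2 := by
        rw [abs_of_nonneg (sq_nonneg w)]
        have := abs_add_le 1 w
        rw [abs_one] at this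
        linarith
  have e2 (w : ℝ) (hw : 0 ≤ w) : w ^ 2 / 2 ≤ Real.exp w := by
    simpa using Real.pow_div_factorial_le_exp w hw 2
  have e3 (w : ℝ) (hw : 0 ≤ w) : w ^ 3 / 6 ≤ Real.exp w := by
    simpa [Nat.factorial] using Real.pow_div_factorial_le_exp w hw 3
  have key (w : ℝ) (hw : 0 ≤ w) : |profileXT w| ≤ (1 + w + w ^ 2) * Real.exp (-w) := by
    rw [profileXT, abs_mul, abs_of_pos (Real.exp_pos _)]
    have := h1 w
    rw [abs_of_nonneg hw] at this
    gcongr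
  refine ⟨by unfold profileXT; fun_prop, fun w hw => ?_, fun w hw => ?_, fun w hw => ?_⟩
  · refine (key w hw).trans ?_
    rw [Real.exp_neg, ← div_eq_mul_inv, div_le_iff₀ (Real.exp_pos _)]
    linarith [Real.add_one_le_exp w, e2 w hw]
  · have hle := Real.exp_le_one_iff.2 (neg_nonpos.2 hw)
    have hE : (1 + w) * Real.exp (-w) ≤ 1 := by
      rw [Real.exp_neg, ← div_eq_mul_inv, div_le_iff₀ (Real.exp_pos _)]
      linarith [Real.add_one_le_exp w]
    have hp := Real.exp_pos (-w)
    have hl := Real.add_one_le_exp (-w)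
    have h3 : w * ((1 + w) * Real.exp (-w)) ≤ w := mul_le_of_le_one_right hw hE
    have h4 : 0 ≤ w * Real.exp (-w) := by positivity
    have h5 : 0 ≤ w ^ 2 * Real.exp (-w) := by positivity
    rw [abs_le, profileXT]
    constructor <;> nlinarith
  · refine (mul_le_mul_of_nonneg_left (key w hw) hw).trans ?_
    rw [Real.exp_neg, ← div_eq_mul_inv, ← mul_div_assoc, div_le_iff₀ (Real.exp_pos _)]
    linarith [Real.add_one_le_exp w, e2 w hw, e3 w hw]

theorem hasDerivAt_profileXT (w : ℝ) :
    HasDerivAt profileXT ((w ^ 2 - 3 * w) * Real.exp (-w)) w := by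
  have h1 : HasDerivAt (fun w : ℝ => 1 + w - w ^ 2) (1 - 2 * w) w := by
    refine (((hasDerivAt_id w).const_add 1).sub (hasDerivAt_pow 2 w)).congr_deriv ?_
    norm_num
  have h2 : HasDerivAt (fun w : ℝ => Real.exp (-w)) (Real.exp (-w) * (-1)) w :=
    (hasDerivAt_neg w).exp
  refine (h1.mul h2).congr_deriv ?_
  ring

theorem hasDerivAt_const_div (a : ℝ) {t : ℝ} (ht : t ≠ 0) :
    HasDerivAt (fun t : ℝ => a / t) (-a / t ^ 2) t := by
  refine ((hasDerivAt_inv ht).const_mul a).congr_deriv ?_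
  ring

theorem integral_profileXT {a ε L : ℝ} (ha : a ≠ 0) (hε : 0 < ε) (hL : ε ≤ L) :
    ∫ t in ε..L, t * ((3 / 2) / t ^ 4 - (a / 2) / t ^ 5) * Real.exp (-(a / t)) =
      1 / 2 / a ^ 2 * (profileXT (a / L) - profileXT (a / ε)) := by
  have hpos : ∀ t ∈ Set.uIcc ε L, t ≠ 0 := fun t ht => by
    rw [Set.uIcc_of_le hL] at ht
    exact (hε.trans_le ht.1).ne'
  rw [mul_sub]
  refine intervalIntegral.integral_eq_sub_of_hasDerivAt
    (f := fun t => 1 / 2 / a ^ 2 * profileXT (a / t)) (fun t ht => ?_) ?_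
  · have h0 := hpos t ht
    refine (((hasDerivAt_profileXT (a / t)).comp t (hasDerivAt_const_div a h0)).const_mul
      (1 / 2 / a ^ 2)).congr_deriv ?_
    field_simp
    ring
  · refine ContinuousOn.intervalIntegrable ?_
    fun_prop (disch := simpa using hpos)

theorem integral_exp_neg_div {a ε L : ℝ} (ha : a ≠ 0) (hε : 0 < ε) (hL : ε ≤ L) :
    ∫ t in ε..L, t * (1 / (2 * t ^ 3)) * Real.exp (-(a / t)) =
      1 / 2 / a * (Real.exp (-(a / L)) - Real.exp (-(a / ε))) := by
  have hpos : ∀ t ∈ Set.uIcc ε L, t ≠ 0 := fun t ht => by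
    rw [Set.uIcc_of_le hL] at ht
    exact (hε.trans_le ht.1).ne'
  rw [mul_sub]
  refine intervalIntegral.integral_eq_sub_of_hasDerivAt
    (f := fun t => 1 / 2 / a * Real.exp (-(a / t))) (fun t ht => ?_) ?_
  · have h0 := hpos t ht
    refine (((hasDerivAt_const_div a h0).neg.exp).const_mul (1 / 2 / a)).congr_deriv ?_
    simp only [Pi.neg_apply]
    field_simp
  · refine ContinuousOn.intervalIntegrable ?_
    fun_prop (disch := simpa using hpos)

theorem intervalIntegrable_of_abs_le {F : ℝ → ℝ} {D a b : ℝ} (hab : a ≤ b) (hF : Measurable F)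
    (hD : ∀ y, a < y → y ≤ b → |F y| ≤ D) : IntervalIntegrable F volume a b := by
  refine (intervalIntegrable_const (c := D)).mono_fun' hF.aestronglyMeasurable ?_
  filter_upwards [ae_restrict_mem measurableSet_uIoc] with y hy
  rw [Set.uIoc_of_le hab] at hy
  exact hD y hy.1 hy.2

/-- The logarithmic divergence of a scale-invariant integral cut off at scale `η`. -/
theorem exists_tendsto_integral_comp_div_add_log {h : ℝ → ℝ} {D : ℝ} (hc : Continuous h)
    (h0 : ∀ s, 0 < s → |h s| ≤ D * s) (h1 : ∀ s, 0 < s → |h s - 1| ≤ D / s) :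
    ∃ c : ℝ, Tendsto (fun η : ℝ => (∫ y in (0 : ℝ)..1, h (y / η) / y) + Real.log η)
      (𝓝[>] 0) (𝓝 c) := by
  have hm := hc.measurable
  have hint : IntegrableOn (fun w => (h w - 1) / w) (Set.Ioi 1) := by
    have hb : IntegrableOn (fun w : ℝ => D * w ^ (-2 : ℝ)) (Set.Ioi 1) :=
      (integrableOn_Ioi_rpow_of_lt (by norm_num) one_pos).const_mul D
    refine hb.mono' (Measurable.aestronglyMeasurable (by fun_prop)) ?_
    filter_upwards [ae_restrict_mem measurableSet_Ioi] with w hw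
    have hw0 : (0 : ℝ) < w := one_pos.trans hw
    rw [Real.norm_eq_abs, abs_div, abs_of_pos hw0, div_le_iff₀ hw0]
    refine (h1 w hw0).trans_eq ?_
    rw [show (-2 : ℝ) = ((-2 : ℤ) : ℝ) by norm_num, Real.rpow_intCast]
    field_simp
  have hlim : Tendsto (fun η : ℝ => ∫ w in (1 : ℝ)..η⁻¹, (h w - 1) / w) (𝓝[>] 0)
      (𝓝 (∫ w in Set.Ioi 1, (h w - 1) / w)) :=
    intervalIntegral_tendsto_integral_Ioi 1 hint tendsto_inv_nhdsGT_zero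
  refine ⟨_, ((tendsto_const_nhds (x := ∫ w in (0 : ℝ)..1, h w / w)).add hlim).congr' ?_⟩
  filter_upwards [Ioo_mem_nhdsGT (zero_lt_one (α := ℝ))] with η hη
  have hη0 : 0 < η := hη.1
  have hinv : 1 ≤ η⁻¹ := (one_le_inv₀ hη0).2 hη.2.le
  have e1 : ∫ y in (0 : ℝ)..1, h (y / η) / y = ∫ w in (0 : ℝ)..η⁻¹, h w / w := by
    have := intervalIntegral.integral_comp_div (a := 0) (b := 1) (fun w => h w / w) hη0.ne'
    rw [zero_div, one_div] at this
    rw [← inv_mul_cancel_left₀ hη0.ne' (∫ w in (0 : ℝ)..η⁻¹, h w / w), ← smul_eq_mul η,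
      ← this, ← intervalIntegral.integral_const_mul]
    refine intervalIntegral.integral_congr fun y _ => ?_
    field_simp
  have i01 : IntervalIntegrable (fun w => h w / w) volume 0 1 :=
    intervalIntegrable_of_abs_le (D := D) zero_le_one (by fun_prop) fun y hy _ => by
      rw [abs_div, abs_of_pos hy, div_le_iff₀ hy]
      exact h0 y hy
  have hne : ∀ w ∈ Set.uIcc 1 η⁻¹, w ≠ 0 := fun w hw => by
    rw [Set.uIcc_of_le hinv] at hw
    exact (one_pos.trans_le hw.1).ne'
  have i1 : IntervalIntegrable (fun w => h w / w) volume 1 η⁻¹ :=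
    (hc.continuousOn.div continuousOn_id hne).intervalIntegrable
  have i2 : IntervalIntegrable (fun w : ℝ => 1 / w) volume 1 η⁻¹ :=
    (continuousOn_const.div continuousOn_id hne).intervalIntegrable
  have e2 : ∫ w in (1 : ℝ)..η⁻¹, (h w - 1) / w =
      (∫ w in (1 : ℝ)..η⁻¹, h w / w) + Real.log η := by
    simp_rw [sub_div]
    rw [intervalIntegral.integral_sub i1 i2, integral_one_div_of_pos one_pos (by positivity),
      div_one, Real.log_inv, sub_neg_eq_add]
  rw [e1, e2, ← intervalIntegral.integral_add_adjacent_intervals i01 i1, add_assoc]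

theorem tendsto_comp_div_nhdsGT_zero {f : ℝ → ℝ} {C y : ℝ}
    (hf : ∀ s, 0 < s → |f s| ≤ C / s) (hy : 0 < y) :
    Tendsto (fun η : ℝ => f (y / η)) (𝓝[>] 0) (𝓝 0) := by
  refine squeeze_zero_norm' (a := fun η => C / y * η) ?_ ?_
  · filter_upwards [self_mem_nhdsWithin] with η hη
    refine (hf _ (div_pos hy hη)).trans_eq ?_
    rw [div_div_eq_mul_div, div_mul_eq_mul_div]
  · have : Tendsto (fun η : ℝ => C / y * η) (𝓝 0) (𝓝 (C / y * 0)) :=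
      tendsto_id.const_mul _
    rw [mul_zero] at this
    exact this.mono_left nhdsWithin_le_nhds

/-- Two profiles decaying at infinity and normalised at the origin, each differenced between the
scales `ℓ` and `η`, have a logarithmically divergent product against `dy / y`. -/
theorem exists_tendsto_integral_mul_add_log {f g : ℝ → ℝ} {C ℓ : ℝ} (hℓ : 0 < ℓ)
    (hfc : Continuous f) (hgc : Continuous g)
    (hf : ∀ s, 0 < s → |f s| ≤ C) (hg : ∀ s, 0 < s → |g s| ≤ C)
    (hf1 : ∀ s, 0 < s → |f s - 1| ≤ C * s) (hg1 : ∀ s, 0 < s → |g s - 1| ≤ C * s)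
    (hf2 : ∀ s, 0 < s → |f s| ≤ C / s) (hg2 : ∀ s, 0 < s → |g s| ≤ C / s) :
    ∃ c : ℝ, Tendsto (fun η : ℝ =>
      (∫ y in (0 : ℝ)..1, (f (y / ℓ) - f (y / η)) * (g (y / ℓ) - g (y / η)) / y) + Real.log η)
      (𝓝[>] 0) (𝓝 c) := by
  have hC : 0 ≤ C := (abs_nonneg _).trans (hf 1 one_pos)
  have hfm := hfc.measurable
  have hgm := hgc.measurable
  have sub_le (u v : ℝ) : |u - v| ≤ |u| + |v| := abs_sub u v
  obtain ⟨c, hc⟩ := exists_tendsto_integral_comp_div_add_log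
    (h := fun s => (1 - f s) * (1 - g s)) (D := C * (1 + C) + 2 * C) (by fun_prop)
    (fun s hs => by
      rw [abs_mul, abs_sub_comm 1]
      have h2 : |1 - g s| ≤ 1 + C := (sub_le _ _).trans (by rw [abs_one]; linarith [hg s hs])
      calc |f s - 1| * |1 - g s| ≤ C * s * (1 + C) := by
            gcongr
            exact hf1 s hs
        _ ≤ _ := by nlinarith [mul_nonneg hC hs.le])
    (fun s hs => by
      have e : (1 - f s) * (1 - g s) - 1 = f s * g s - (f s + g s) := by ring
      rw [e]
      calc |f s * g s - (f s + g s)| ≤ |f s| * |g s| + (|f s| + |g s|) := by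
            rw [← abs_mul]
            exact (sub_le _ _).trans (by gcongr; exact abs_add_le _ _)
        _ ≤ C / s * C + (C / s + C / s) := by
            gcongr
            exacts [hf2 s hs, hg s hs, hf2 s hs, hg2 s hs]
        _ ≤ (C * (1 + C) + 2 * C) / s := by
            rw [le_div_iff₀ hs]
            field_simp
            nlinarith)
  set R : ℝ → ℝ → ℝ := fun η y =>
    ((f (y / ℓ) - 1) * (g (y / ℓ) - g (y / η)) + (1 - f (y / η)) * (g (y / ℓ) - 1)) / y with hR
  have hRb : ∀ η, 0 < η → ∀ y, 0 < y → |R η y| ≤ C / ℓ * (2 * C) + (1 + C) * (C / ℓ) := by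
    intro η hη y hy
    have hyl := div_pos hy hℓ
    have hyη := div_pos hy hη
    rw [hR, abs_div, abs_of_pos hy, div_le_iff₀ hy]
    refine (abs_add_le _ _).trans ?_
    rw [abs_mul, abs_mul]
    have b1 := hf1 _ hyl
    have b2 : |g (y / ℓ) - g (y / η)| ≤ 2 * C :=
      (sub_le _ _).trans (by linarith [hg _ hyl, hg _ hyη])
    have b3 : |1 - f (y / η)| ≤ 1 + C :=
      (sub_le _ _).trans (by rw [abs_one]; linarith [hf _ hyη])
    have b4 := hg1 _ hyl
    calc _ ≤ C * (y / ℓ) * (2 * C) + (1 + C) * (C * (y / ℓ)) := by gcongr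
      _ = _ := by ring
  have hRm : ∀ η, Measurable (R η) := fun η => by rw [hR]; fun_prop
  have hRlim : Tendsto (fun η => ∫ y in (0 : ℝ)..1, R η y) (𝓝[>] 0)
      (𝓝 (∫ y in (0 : ℝ)..1,
        ((f (y / ℓ) - 1) * (g (y / ℓ) - 0) + (1 - 0) * (g (y / ℓ) - 1)) / y)) := by
    refine intervalIntegral.tendsto_integral_filter_of_dominated_convergence
      (fun _ => C / ℓ * (2 * C) + (1 + C) * (C / ℓ))
      (Eventually.of_forall fun η => (hRm η).aestronglyMeasurable) ?_
      intervalIntegrable_const ?_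
    · filter_upwards [self_mem_nhdsWithin] with η hη
      refine Eventually.of_forall fun y hy => ?_
      rw [Set.uIoc_of_le zero_le_one] at hy
      exact hRb η hη y hy.1
    · refine Eventually.of_forall fun y hy => ?_
      rw [Set.uIoc_of_le zero_le_one] at hy
      have tf := tendsto_comp_div_nhdsGT_zero hf2 hy.1
      have tg := tendsto_comp_div_nhdsGT_zero hg2 hy.1
      exact (((tg.const_sub _).const_mul _).add ((tf.const_sub _).mul_const _)).div_const _
  refine ⟨_, (hc.add hRlim).congr' ?_⟩
  filter_upwards [self_mem_nhdsWithin] with η hη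
  have hη0 : 0 < η := hη
  have iR : IntervalIntegrable (R η) volume 0 1 :=
    intervalIntegrable_of_abs_le zero_le_one (hRm η) fun y hy _ => hRb η hη0 y hy
  have iA : IntervalIntegrable (fun y => (1 - f (y / η)) * (1 - g (y / η)) / y) volume 0 1 := by
    refine intervalIntegrable_of_abs_le (D := C / η * (1 + C)) zero_le_one (by fun_prop)
      fun y hy _ => ?_
    have hyη := div_pos hy hη0
    rw [abs_div, abs_of_pos hy, div_le_iff₀ hy, abs_mul, abs_sub_comm 1]
    have b1 := hf1 _ hyη
    have b2 : |1 - g (y / η)| ≤ 1 + C :=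
      (sub_le _ _).trans (by rw [abs_one]; linarith [hg _ hyη])
    calc _ ≤ C * (y / η) * (1 + C) := by gcongr
      _ = _ := by ring
  rw [add_right_comm, ← intervalIntegral.integral_add iA iR]
  congr 1
  refine intervalIntegral.integral_congr fun y _ => ?_
  simp only [hR]
  ring

theorem abs_coord_mul_coord_le {n : ℕ} (z : EuclideanSpace ℝ (Fin n)) (i j : Fin n) :
    |z i * z j| ≤ ‖z‖ ^ 2 := by
  rw [abs_mul, sq]
  exact mul_le_mul (PiLp.norm_apply_le z i) (PiLp.norm_apply_le z j) (abs_nonneg _) (norm_nonneg _)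

theorem integral_coord_mul_coord_mul_radial {n : ℕ} {F : ℝ → ℝ} (hF : Measurable F)
    (hint : Integrable fun z : EuclideanSpace ℝ (Fin n) => ‖z‖ ^ 2 * F ‖z‖) (i j : Fin n) :
    ∫ z : EuclideanSpace ℝ (Fin n), z i * z j * F ‖z‖ =
      (if i = j then (1 : ℝ) else 0) / n *
        ∫ z : EuclideanSpace ℝ (Fin n), ‖z‖ ^ 2 * F ‖z‖ := by
  split_ifs with hij
  · subst hij
    have hI : ∀ k : Fin n, Integrable fun z : EuclideanSpace ℝ (Fin n) => z k * z k * F ‖z‖ := by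
      intro k
      refine hint.mono (Measurable.aestronglyMeasurable (by fun_prop)) (Eventually.of_forall ?_)
      intro z
      rw [norm_mul, norm_mul _ (F ‖z‖)]
      gcongr
      exact (abs_coord_mul_coord_le z k k).trans (le_abs_self _)
    have hsymm : ∀ k : Fin n, ∫ z : EuclideanSpace ℝ (Fin n), z k * z k * F ‖z‖ =
        ∫ z : EuclideanSpace ℝ (Fin n), z i * z i * F ‖z‖ := by
      intro k
      let e := LinearIsometryEquiv.piLpCongrLeft 2 ℝ ℝ (Equiv.swap i k)
      rw [← e.measurePreserving.integral_comp e.toHomeomorph.measurableEmbedding]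
      refine integral_congr_ae (Eventually.of_forall fun z => ?_)
      have : e z k = z i := by
        simp [e, LinearIsometryEquiv.piLpCongrLeft_apply, Equiv.piCongrLeft'_apply]
      simp only [this, LinearIsometryEquiv.norm_map]
    have hsum : ∫ z : EuclideanSpace ℝ (Fin n), ‖z‖ ^ 2 * F ‖z‖ =
        n * ∫ z : EuclideanSpace ℝ (Fin n), z i * z i * F ‖z‖ := by
      have : ∀ z : EuclideanSpace ℝ (Fin n), ‖z‖ ^ 2 * F ‖z‖ = ∑ k, z k * z k * F ‖z‖ := by
        intro z
        rw [EuclideanSpace.norm_sq_eq, Finset.sum_mul]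
        simp [sq]
      simp_rw [this]
      rw [integral_finsetSum _ fun k _ => hI k, Finset.sum_congr rfl fun k _ => hsymm k]
      simp
    have hn : (n : ℝ) ≠ 0 := Nat.cast_ne_zero.2 (Fin.pos i).ne'
    rw [hsum]
    field_simp
  · rw [zero_div, zero_mul]
    let e := LinearIsometryEquiv.piLpCongrRight 2 (fun k : Fin n =>
      if k = i then LinearIsometryEquiv.neg ℝ (E := ℝ) else LinearIsometryEquiv.refl ℝ ℝ)
    have h := e.measurePreserving.integral_comp e.toHomeomorph.measurableEmbedding
      (fun z : EuclideanSpace ℝ (Fin n) => z i * z j * F ‖z‖)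
    have hneg : ∀ z, e z i * e z j * F ‖e z‖ = -(z i * z j * F ‖z‖) := by
      intro z
      have h1 : e z i = -z i := by simp [e]
      have h2 : e z j = z j := by simp [e, Ne.symm hij]
      rw [h1, h2, LinearIsometryEquiv.norm_map]
      ring
    simp_rw [hneg] at h
    rw [integral_neg] at h
    linarith

theorem volume_real_ball_four :
    (volume : Measure (EuclideanSpace ℝ (Fin 4))).real (Metric.ball 0 1) = Real.pi ^ 2 / 2 := by
  rw [Measure.real, EuclideanSpace.volume_ball]
  have h1 : √Real.pi ^ 4 = Real.pi ^ 2 := by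
    rw [show 4 = 2 * 2 by rfl, pow_mul, Real.sq_sqrt Real.pi_pos.le]
  have h2 : Real.Gamma ((4 : ℕ) / 2 + 1) = 2 := by
    have := Real.Gamma_nat_eq_factorial 2
    norm_num [Nat.factorial] at this ⊢
  rw [Fintype.card_fin, h1, h2]
  simp [ENNReal.toReal_ofReal (by positivity : 0 ≤ Real.pi ^ 2 / 2)]

theorem integral_radial_four (G : ℝ → ℝ) :
    ∫ z : EuclideanSpace ℝ (Fin 4), G ‖z‖ =
      2 * Real.pi ^ 2 * ∫ y in Set.Ioi (0 : ℝ), y ^ 3 * G y := by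
  rw [integral_fun_norm_addHaar volume G, volume_real_ball_four, finrank_euclideanSpace_fin]
  simp only [smul_eq_mul, nsmul_eq_mul]
  push_cast
  ring

theorem integrable_indicator_norm_pow_three_inv (R : ℝ) :
    Integrable fun z : EuclideanSpace ℝ (Fin 4) =>
      (Set.Iic R).indicator (fun r => (r ^ 3)⁻¹) ‖z‖ := by
  rw [integrable_fun_norm_addHaar volume (f := (Set.Iic R).indicator fun r => (r ^ 3)⁻¹),
    finrank_euclideanSpace_fin]
  have h : IntegrableOn ((Set.Iic R).indicator fun _ => (1 : ℝ)) (Set.Ioi 0) := by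
    rw [IntegrableOn, integrable_indicator_iff measurableSet_Iic, IntegrableOn,
      Measure.restrict_restrict measurableSet_Iic, Set.Iic_inter_Ioi]
    exact integrableOn_const (by simp)
  refine h.congr_fun (fun y hy => ?_) measurableSet_Ioi
  have hy0 : y ≠ 0 := (Set.mem_Ioi.1 hy).ne'
  by_cases hyR : y ∈ Set.Iic R
  · simp [hyR, hy0]
  · simp [hyR]

/-- The radial factor of the time-integrated kernel, for profiles `p` and `q` differenced between
the times `L` and `ε`. -/
noncomputable def cutoffRadial (p q : ℝ → ℝ) (L ε r : ℝ) : ℝ :=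
  (p (r ^ 2 / (4 * L)) - p (r ^ 2 / (4 * ε))) * (q (r ^ 2 / (4 * L)) - q (r ^ 2 / (4 * ε))) / r ^ 6

theorem IsCutoff.nonneg {p : ℝ → ℝ} {C : ℝ} (hp : IsCutoff p C) : 0 ≤ C :=
  (abs_nonneg _).trans (hp.abs_le 0 le_rfl)

theorem measurable_cutoffRadial {p q : ℝ → ℝ} {C : ℝ} (hp : IsCutoff p C) (hq : IsCutoff q C)
    (L ε : ℝ) : Measurable (cutoffRadial p q L ε) := by
  have := hp.continuous.measurable
  have := hq.continuous.measurable
  unfold cutoffRadial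
  fun_prop

theorem IsCutoff.abs_sub_le {p : ℝ → ℝ} {C u v : ℝ} (hp : IsCutoff p C) (hu : 0 ≤ u)
    (hv : 0 ≤ v) : |p u - p v| ≤ 2 * C :=
  (abs_sub _ _).trans (by linarith [hp.abs_le u hu, hp.abs_le v hv])

theorem IsCutoff.abs_sub_le_mul {p : ℝ → ℝ} {C u v : ℝ} (hp : IsCutoff p C) (hu : 0 ≤ u)
    (hv : 0 ≤ v) : |p u - p v| ≤ C * (u + v) := by
  have h := abs_sub (p u - 1) (p v - 1)
  rw [sub_sub_sub_cancel_right] at h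
  linarith [hp.abs_sub_one_le u hu, hp.abs_sub_one_le v hv]

theorem abs_cutoffRadial_le {p q : ℝ → ℝ} {C L ε : ℝ} (hp : IsCutoff p C) (hq : IsCutoff q C)
    (hL : 0 < L) (hε : 0 < ε) (r : ℝ) : |cutoffRadial p q L ε r| ≤ (2 * C) ^ 2 / r ^ 6 := by
  have hC := hp.nonneg
  rw [cutoffRadial, abs_div, abs_mul, abs_of_nonneg (by positivity : 0 ≤ r ^ 6), sq (2 * C)]
  gcongr
  exacts [hp.abs_sub_le (by positivity) (by positivity),
    hq.abs_sub_le (by positivity) (by positivity)]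

theorem sq_mul_abs_cutoffRadial_le {p q : ℝ → ℝ} {C L ε : ℝ} (hp : IsCutoff p C)
    (hq : IsCutoff q C) (hL : 0 < L) (hε : 0 < ε) (r : ℝ) :
    r ^ 2 * |cutoffRadial p q L ε r| ≤ (C * (1 / (4 * L) + 1 / (4 * ε))) ^ 2 := by
  have hC := hp.nonneg
  rcases eq_or_ne r 0 with rfl | hr
  · rw [zero_pow two_ne_zero, zero_mul]
    positivity
  have h6 : 0 < r ^ 6 := by positivity
  rw [cutoffRadial, abs_div, abs_mul, abs_of_pos h6, ← mul_div_assoc, div_le_iff₀ h6]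
  have b1 := hp.abs_sub_le_mul (u := r ^ 2 / (4 * L)) (v := r ^ 2 / (4 * ε))
    (by positivity) (by positivity)
  have b2 := hq.abs_sub_le_mul (u := r ^ 2 / (4 * L)) (v := r ^ 2 / (4 * ε))
    (by positivity) (by positivity)
  calc _ ≤ r ^ 2 * ((C * (r ^ 2 / (4 * L) + r ^ 2 / (4 * ε))) *
        (C * (r ^ 2 / (4 * L) + r ^ 2 / (4 * ε)))) := by gcongr
    _ = _ := by ring

/-- The time-integrated kernel on `ℝ⁴`, up to a numerical factor. -/
noncomputable def cutoffKernel (p q : ℝ → ℝ) (i j : Fin 4) (L ε : ℝ)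
    (z : EuclideanSpace ℝ (Fin 4)) : ℝ :=
  z i * z j * cutoffRadial p q L ε ‖z‖

theorem measurable_cutoffKernel {p q : ℝ → ℝ} {C : ℝ} (hp : IsCutoff p C) (hq : IsCutoff q C)
    (i j : Fin 4) (L ε : ℝ) : Measurable (cutoffKernel p q i j L ε) := by
  have := measurable_cutoffRadial hp hq L ε
  unfold cutoffKernel
  fun_prop

theorem abs_cutoffKernel_le {p q : ℝ → ℝ} {C L ε : ℝ} (hp : IsCutoff p C) (hq : IsCutoff q C)
    (hL : 0 < L) (hε : 0 < ε) (i j : Fin 4) (z : EuclideanSpace ℝ (Fin 4)) :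
    |cutoffKernel p q i j L ε z| ≤ (C * (1 / (4 * L) + 1 / (4 * ε))) ^ 2 := by
  rw [cutoffKernel, abs_mul]
  exact (mul_le_mul_of_nonneg_right (abs_coord_mul_coord_le z i j) (abs_nonneg _)).trans
    (sq_mul_abs_cutoffRadial_le hp hq hL hε _)

theorem exists_tendsto_integral_ball_cutoffKernel {p q : ℝ → ℝ} {C L : ℝ} (hp : IsCutoff p C)
    (hq : IsCutoff q C) (hL : 0 < L) (i j : Fin 4) :
    ∃ c : ℝ, Tendsto (fun ε : ℝ =>
      (∫ z in {z : EuclideanSpace ℝ (Fin 4) | ‖z‖ ≤ 1}, cutoffKernel p q i j L ε z) +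
        (if i = j then (1 : ℝ) else 0) * (Real.pi ^ 2 / 4) * Real.log ε) (𝓝[>] 0) (𝓝 c) := by
  have hC := hp.nonneg
  have hpos (s : ℝ) : 0 ≤ s ^ 2 / 4 := by positivity
  have near {f : ℝ → ℝ} (hf : IsCutoff f C) (s : ℝ) (hs : 0 < s) :
      |f (s ^ 2 / 4) - 1| ≤ (4 * C + 1) * s := by
    rcases le_total s 1 with h | h
    · have := hf.abs_sub_one_le _ (hpos s)
      nlinarith [mul_nonneg hC hs.le, mul_nonneg (mul_nonneg hC hs.le) (sub_nonneg.2 h)]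
    · have := (abs_sub (f (s ^ 2 / 4)) 1).trans
        (add_le_add_left (hf.abs_le _ (hpos s)) |1|)
      rw [abs_one] at this
      nlinarith
  have far {f : ℝ → ℝ} (hf : IsCutoff f C) (s : ℝ) (hs : 0 < s) :
      |f (s ^ 2 / 4)| ≤ (4 * C + 1) / s := by
    rw [le_div_iff₀ hs]
    have b1 := hf.abs_le _ (hpos s)
    have b2 := hf.mul_abs_le _ (hpos s)
    have b3 := abs_nonneg (f (s ^ 2 / 4))
    rcases le_total s 1 with h | h
    · nlinarith
    · nlinarith [mul_nonneg (mul_nonneg b3 hs.le) (sub_nonneg.2 h)]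
  have bdd {f : ℝ → ℝ} (hf : IsCutoff f C) (s : ℝ) (_ : 0 < s) :
      |f (s ^ 2 / 4)| ≤ 4 * C + 1 := by
    linarith [hf.abs_le _ (hpos s)]
  have hpc := hp.continuous
  have hqc := hq.continuous
  obtain ⟨c, hc⟩ := exists_tendsto_integral_mul_add_log (Real.sqrt_pos.2 hL)
    (f := fun s => p (s ^ 2 / 4)) (g := fun s => q (s ^ 2 / 4)) (by fun_prop) (by fun_prop)
    (bdd hp) (bdd hq) (near hp) (near hq) (far hp) (far hq)
  have hsqrt : Tendsto Real.sqrt (𝓝[>] 0) (𝓝[>] 0) := by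
    refine tendsto_nhdsWithin_iff.2 ⟨?_, ?_⟩
    · have := Real.continuous_sqrt.tendsto 0
      rw [Real.sqrt_zero] at this
      exact this.mono_left nhdsWithin_le_nhds
    · filter_upwards [self_mem_nhdsWithin] with ε hε using Real.sqrt_pos.2 hε
  refine ⟨_, ((hc.comp hsqrt).const_mul
    ((if i = j then (1 : ℝ) else 0) * (Real.pi ^ 2 / 2))).congr' ?_⟩
  filter_upwards [self_mem_nhdsWithin] with ε hε
  have hε0 : 0 < ε := hε
  have hrm := measurable_cutoffRadial hp hq L ε
  set F : ℝ → ℝ := (Set.Iic 1).indicator (cutoffRadial p q L ε) with hF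
  have hFm : Measurable F := hrm.indicator measurableSet_Iic
  have hB : MeasurableSet {z : EuclideanSpace ℝ (Fin 4) | ‖z‖ ≤ 1} :=
    measurableSet_le measurable_norm measurable_const
  have hint : Integrable fun z : EuclideanSpace ℝ (Fin 4) => ‖z‖ ^ 2 * F ‖z‖ := by
    have hball : volume {z : EuclideanSpace ℝ (Fin 4) | ‖z‖ ≤ 1} ≠ ⊤ := by
      have : {z : EuclideanSpace ℝ (Fin 4) | ‖z‖ ≤ 1} = Metric.closedBall 0 1 := by
        ext z
        simp
      rw [this]
      exact measure_closedBall_lt_top.ne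
    have h1 : IntegrableOn (fun z : EuclideanSpace ℝ (Fin 4) =>
        ‖z‖ ^ 2 * cutoffRadial p q L ε ‖z‖) {z | ‖z‖ ≤ 1} := by
      refine Measure.integrableOn_of_bounded hball
        (Measurable.aestronglyMeasurable (by fun_prop))
        (M := (C * (1 / (4 * L) + 1 / (4 * ε))) ^ 2) (Eventually.of_forall fun z => ?_)
      rw [norm_mul, Real.norm_of_nonneg (sq_nonneg _)]
      exact sq_mul_abs_cutoffRadial_le hp hq hL hε0 _
    refine ((integrable_indicator_iff hB).2 h1).congr (Eventually.of_forall fun z => ?_)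
    by_cases hz : ‖z‖ ≤ 1 <;> simp [hF, hz]
  have e1 : ∫ z in {z : EuclideanSpace ℝ (Fin 4) | ‖z‖ ≤ 1}, cutoffKernel p q i j L ε z =
      ∫ z : EuclideanSpace ℝ (Fin 4), z i * z j * F ‖z‖ := by
    rw [← integral_indicator hB]
    refine integral_congr_ae (Eventually.of_forall fun z => ?_)
    by_cases hz : ‖z‖ ≤ 1 <;> simp [hF, hz, cutoffKernel]
  have e2 : ∫ y in Set.Ioi (0 : ℝ), y ^ 3 * (y ^ 2 * F y) =
      ∫ y in (0 : ℝ)..1, (p ((y / √L) ^ 2 / 4) - p ((y / √ε) ^ 2 / 4)) *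
        (q ((y / √L) ^ 2 / 4) - q ((y / √ε) ^ 2 / 4)) / y := by
    rw [intervalIntegral.integral_of_le zero_le_one, ← Set.Iic_inter_Ioi,
      ← Measure.restrict_restrict measurableSet_Iic, ← integral_indicator measurableSet_Iic]
    refine setIntegral_congr_fun measurableSet_Ioi fun y hy => ?_
    have hy0 : y ≠ 0 := (Set.mem_Ioi.1 hy).ne'
    by_cases hy1 : y ∈ Set.Iic (1 : ℝ)
    · simp only [hF, Set.indicator_of_mem hy1, cutoffRadial, div_pow, Real.sq_sqrt hL.le,
        Real.sq_sqrt hε0.le, div_div, mul_comm (4 : ℝ)]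
      field_simp
    · simp [hF, hy1]
  rw [e1, integral_coord_mul_coord_mul_radial hFm hint,
    integral_radial_four fun r => r ^ 2 * F r, e2]
  simp only [Function.comp, Real.log_sqrt hε0.le]
  push_cast
  ring

theorem tendsto_cutoffKernel {p q : ℝ → ℝ} {C : ℝ} (hp : IsCutoff p C) (hq : IsCutoff q C)
    (i j : Fin 4) (L : ℝ) (z : EuclideanSpace ℝ (Fin 4)) :
    ∃ k : ℝ, Tendsto (fun ε => cutoffKernel p q i j L ε z) (𝓝[>] 0) (𝓝 k) := by
  rcases eq_or_ne z 0 with rfl | hz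
  · exact ⟨0, by simp [cutoffKernel]⟩
  have ha : 0 < ‖z‖ ^ 2 / 4 := by positivity
  have lim {f : ℝ → ℝ} (hf : IsCutoff f C) :
      Tendsto (fun ε : ℝ => f (‖z‖ ^ 2 / (4 * ε))) (𝓝[>] 0) (𝓝 0) := by
    have := tendsto_comp_div_nhdsGT_zero (f := f) (C := C) (fun s hs => by
      rw [le_div_iff₀ hs, mul_comm]
      exact hf.mul_abs_le s hs.le) ha
    simpa only [div_div] using this
  exact ⟨_, ((((lim hp).const_sub _).mul ((lim hq).const_sub _)).div_const _).const_mul _⟩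

/-- Integrating the kernel against a function that is compactly supported and Lipschitz at the
origin produces a logarithmic divergence proportional to the value at the origin. -/
theorem exists_tendsto_integral_mul_cutoffKernel {p q : ℝ → ℝ} {C L A R : ℝ}
    (hp : IsCutoff p C) (hq : IsCutoff q C) (hL : 0 < L) (i j : Fin 4)
    {Φ : EuclideanSpace ℝ (Fin 4) → ℝ} (hΦ : Measurable Φ) (hR : 1 ≤ R)
    (hA : ∀ z, |Φ z - Φ 0| ≤ A * ‖z‖) (hsupp : ∀ z, R < ‖z‖ → Φ z = 0) :
    ∃ c : ℝ, Tendsto (fun ε : ℝ => (∫ z, Φ z * cutoffKernel p q i j L ε z) +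
      (if i = j then (1 : ℝ) else 0) * (Real.pi ^ 2 / 4) * Φ 0 * Real.log ε)
      (𝓝[>] 0) (𝓝 c) := by
  set B : Set (EuclideanSpace ℝ (Fin 4)) := {z | ‖z‖ ≤ 1} with hBdef
  have hB : MeasurableSet B := measurableSet_le measurable_norm measurable_const
  have hBvol : volume B ≠ ⊤ := by
    have : B = Metric.closedBall 0 1 := by
      ext z
      simp [hBdef]
    rw [this]
    exact measure_closedBall_lt_top.ne
  set Ψ : EuclideanSpace ℝ (Fin 4) → ℝ := fun z => Φ z - B.indicator (fun _ => Φ 0) z with hΨ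
  have hΨm : Measurable Ψ := hΦ.sub (measurable_const.indicator hB)
  have hΨb : ∀ z, |Ψ z| ≤ (Set.Iic R).indicator (fun r => (A + |Φ 0|) * r) ‖z‖ := by
    intro z
    by_cases hz : ‖z‖ ≤ 1
    · have h1 : z ∈ B := hz
      have h2 : ‖z‖ ∈ Set.Iic R := hz.trans hR
      rw [hΨ, Set.indicator_of_mem h2]
      simp only [Set.indicator_of_mem h1]
      nlinarith [hA z, mul_nonneg (abs_nonneg (Φ 0)) (norm_nonneg z)]
    · have h1 : z ∉ B := hz
      rw [not_le] at hz
      simp only [hΨ, Set.indicator_of_notMem h1, sub_zero]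
      rcases le_or_gt ‖z‖ R with h2 | h2
      · rw [Set.indicator_of_mem (Set.mem_Iic.2 h2)]
        have h3 := abs_add_le (Φ z - Φ 0) (Φ 0)
        rw [sub_add_cancel] at h3
        nlinarith [hA z, abs_nonneg (Φ 0)]
      · rw [Set.indicator_of_notMem (by simpa using h2), hsupp z h2, abs_zero]
  set bound : EuclideanSpace ℝ (Fin 4) → ℝ := fun z =>
    (A + |Φ 0|) * (2 * C) ^ 2 * (Set.Iic R).indicator (fun r => (r ^ 3)⁻¹) ‖z‖ with hbound
  have hbi : Integrable bound := (integrable_indicator_norm_pow_three_inv R).const_mul _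
  have hKm := measurable_cutoffKernel hp hq i j L
  have hdom : ∀ ε, 0 < ε → ∀ z, ‖Ψ z * cutoffKernel p q i j L ε z‖ ≤ bound z := by
    intro ε hε z
    rw [norm_mul]
    have h1 := hΨb z
    have h2 : |cutoffKernel p q i j L ε z| ≤ ‖z‖ ^ 2 * ((2 * C) ^ 2 / ‖z‖ ^ 6) := by
      rw [cutoffKernel, abs_mul]
      gcongr
      exacts [abs_coord_mul_coord_le z i j, abs_cutoffRadial_le hp hq hL hε _]
    refine (mul_le_mul h1 h2 (abs_nonneg _) ((abs_nonneg _).trans h1)).trans_eq ?_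
    rcases eq_or_ne z 0 with rfl | hz
    · simp [hbound, Set.indicator]
    have hz' : ‖z‖ ≠ 0 := norm_ne_zero_iff.2 hz
    by_cases hzR : ‖z‖ ∈ Set.Iic R
    · simp only [hbound, Set.indicator_of_mem hzR]
      field_simp
    · simp only [hbound, Set.indicator_of_notMem hzR, zero_mul, mul_zero]
  choose k hk using tendsto_cutoffKernel hp hq i j L
  have hlim : Tendsto (fun ε => ∫ z, Ψ z * cutoffKernel p q i j L ε z) (𝓝[>] 0)
      (𝓝 (∫ z, Ψ z * k z)) := by
    refine tendsto_integral_filter_of_dominated_convergence bound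
      (Eventually.of_forall fun ε => (hΨm.mul (hKm ε)).aestronglyMeasurable) ?_ hbi
      (Eventually.of_forall fun z => (hk z).const_mul _)
    filter_upwards [self_mem_nhdsWithin] with ε hε using Eventually.of_forall (hdom ε hε)
  obtain ⟨c, hc⟩ := exists_tendsto_integral_ball_cutoffKernel hp hq hL i j
  refine ⟨_, (hlim.add (hc.const_mul (Φ 0))).congr' ?_⟩
  filter_upwards [self_mem_nhdsWithin] with ε hε
  have hε0 : 0 < ε := hε
  have i1 : Integrable fun z => Ψ z * cutoffKernel p q i j L ε z :=
    hbi.mono' (hΨm.mul (hKm ε)).aestronglyMeasurable (Eventually.of_forall (hdom ε hε0))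
  have i2 : Integrable fun z => Φ 0 * B.indicator (cutoffKernel p q i j L ε) z :=
    ((integrable_indicator_iff hB).2 (Measure.integrableOn_of_bounded hBvol
      (hKm ε).aestronglyMeasurable
      (Eventually.of_forall fun z => abs_cutoffKernel_le hp hq hL hε0 i j z))).const_mul _
  have e : ∫ z, Φ z * cutoffKernel p q i j L ε z =
      (∫ z, Ψ z * cutoffKernel p q i j L ε z) +
        Φ 0 * ∫ z in B, cutoffKernel p q i j L ε z := by
    rw [← integral_indicator hB, ← integral_const_mul, ← integral_add i1 i2]
    refine integral_congr_ae (Eventually.of_forall fun z => ?_)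
    by_cases hz : z ∈ B
    · simp only [hΨ, Set.indicator_of_mem hz]
      ring
    · simp [hΨ, hz]
  rw [e]
  ring

/-- Integration against a translation-invariant kernel reduces to the difference variable. -/
theorem integral_mul_comp_sub {E : Type*} [NormedAddCommGroup E] [MeasurableSpace E]
    [BorelSpace E] [SecondCountableTopology E] (μ : Measure E) [SFinite μ]
    [μ.IsAddRightInvariant] {φ : E × E → ℝ} (hφ : Integrable φ (μ.prod μ)) {K : E → ℝ}
    (hK : Measurable K) {D : ℝ} (hD : ∀ z, |K z| ≤ D) :
    ∫ p, φ p * K (p.1 - p.2) ∂(μ.prod μ) = ∫ z, (∫ y, φ (z + y, y) ∂μ) * K z ∂μ := by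
  have hmp := measurePreserving_add_prod μ μ
  have hint : Integrable (fun p => φ p * K (p.1 - p.2)) (μ.prod μ) :=
    hφ.mul_bdd (Measurable.aestronglyMeasurable (by fun_prop))
      (Eventually.of_forall fun p => hD _)
  have hint' := (hmp.integrable_comp hint.aestronglyMeasurable).2 hint
  have hemb : MeasurableEmbedding fun z : E × E => (z.1 + z.2, z.2) :=
    (MeasurableEquiv.mk
      { toFun := fun z : E × E => (z.1 + z.2, z.2)
        invFun := fun z => (z.1 - z.2, z.2)
        left_inv := fun z => by simp
        right_inv := fun z => by simp }
      (by dsimp; fun_prop) (by dsimp; fun_prop)).measurableEmbedding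
  rw [← hmp.integral_comp hemb]
  refine (integral_prod _ hint').trans ?_
  simp only [Function.comp, add_sub_cancel_right, integral_mul_const]

/-- The fibre integral along the diagonal direction of a test function is Lipschitz at the origin
and supported in a ball. -/
theorem exists_fibre_integral_bounds {E : Type*} [NormedAddCommGroup E] [NormedSpace ℝ E]
    [FiniteDimensional ℝ E] [MeasurableSpace E] [BorelSpace E] (μ : Measure E)
    [IsFiniteMeasureOnCompacts μ] {φ : E × E → ℝ} (hφ : ContDiff ℝ (⊤ : ℕ∞) φ)
    (hφc : HasCompactSupport φ) :
    ∃ A R : ℝ, 1 ≤ R ∧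
      (∀ z, |(∫ y, φ (z + y, y) ∂μ) - ∫ y, φ (0 + y, y) ∂μ| ≤ A * ‖z‖) ∧
      ∀ z, R < ‖z‖ → ∫ y, φ (z + y, y) ∂μ = 0 := by
  obtain ⟨C, hC⟩ := hφ.lipschitzWith_of_hasCompactSupport hφc (by simp)
  have hcomp : IsCompact (tsupport φ) := hφc
  set S : Set E := Prod.snd '' tsupport φ with hS
  have hSc : IsCompact S := hcomp.image continuous_snd
  have hzero : ∀ z y, y ∉ S → φ (z + y, y) = 0 := fun z y hy =>
    image_eq_zero_of_notMem_tsupport fun h => hy ⟨_, h, rfl⟩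
  have hi : ∀ z, Integrable (fun y => φ (z + y, y)) μ := fun z => by
    refine Continuous.integrable_of_hasCompactSupport (hφ.continuous.comp (by fun_prop)) ?_
    exact HasCompactSupport.intro hSc fun y hy => hzero z y hy
  obtain ⟨M, hM⟩ := (hcomp.image (continuous_fst.sub continuous_snd)).isBounded.exists_norm_le
  refine ⟨C * μ.real S, max M 1, le_max_right _ _, fun z => ?_, fun z hz => ?_⟩
  · rw [← integral_sub (hi z) (hi 0)]
    have hrestr : ∫ y, (φ (z + y, y) - φ (0 + y, y)) ∂μ =
        ∫ y in S, (φ (z + y, y) - φ (0 + y, y)) ∂μ := by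
      refine (setIntegral_eq_integral_of_forall_compl_eq_zero fun y hy => ?_).symm
      rw [hzero z y hy, hzero 0 y hy, sub_zero]
    rw [hrestr]
    rw [mul_right_comm, ← Real.norm_eq_abs]
    refine norm_setIntegral_le_of_norm_le_const (μ := μ) hSc.measure_lt_top fun y _ => ?_
    have := hC.dist_le_mul (z + y, y) (0 + y, y)
    rw [dist_eq_norm, dist_eq_norm] at this
    simpa [Prod.norm_def] using this
  · have : ∀ y, φ (z + y, y) = 0 := fun y => by
      refine image_eq_zero_of_notMem_tsupport fun h => ?_
      have := hM _ ⟨_, h, rfl⟩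
      simp only [Pi.sub_apply, add_sub_cancel_right] at this
      exact absurd (hz.trans_le this) (not_lt.2 (le_max_left _ _))
    simp [this]

theorem integral_heatKernel_mul_heatKernel (i j : Fin 4) {ε L : ℝ} (hε : 0 < ε) (hL : ε ≤ L)
    (x y : EuclideanSpace ℝ (Fin 4)) (b : ℝ) :
    ∫ t₁ in ε..L, ∫ t₂ in ε..L,
        b * (t₁ * t₂) * heatKernelDxt i t₁ x y * heatKernelDx j t₂ x y =
      -(1 / (16 * Real.pi ^ 4)) *
        (b * cutoffKernel profileXT (fun w => Real.exp (-w)) i j L ε (x - y)) := by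
  rcases eq_or_ne (x - y) 0 with hxy | hxy
  · have hi : x i - y i = 0 := by rw [← PiLp.sub_apply, hxy, PiLp.zero_apply]
    simp [hxy, cutoffKernel, heatKernelDxt, hi]
  have hr : ‖x - y‖ ≠ 0 := norm_ne_zero_iff.2 hxy
  have ha : ‖x - y‖ ^ 2 / 4 ≠ 0 := by positivity
  have hexp (t : ℝ) : -‖x - y‖ ^ 2 / (4 * t) = -(‖x - y‖ ^ 2 / 4 / t) := by
    rw [div_div, neg_div]
  have hfac (t₁ t₂ : ℝ) :
      b * (t₁ * t₂) * heatKernelDxt i t₁ x y * heatKernelDx j t₂ x y =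
        -(b * (x - y) i * (x - y) j / (4 * Real.pi) ^ 4) *
          (t₁ * ((3 / 2) / t₁ ^ 4 - (‖x - y‖ ^ 2 / 4 / 2) / t₁ ^ 5) *
            Real.exp (-(‖x - y‖ ^ 2 / 4 / t₁))) *
          (t₂ * (1 / (2 * t₂ ^ 3)) * Real.exp (-(‖x - y‖ ^ 2 / 4 / t₂))) := by
    rw [heatKernelDxt, heatKernelDx, hexp, hexp, PiLp.sub_apply, PiLp.sub_apply]
    ring
  simp_rw [hfac, intervalIntegral.integral_const_mul, intervalIntegral.integral_mul_const,
    intervalIntegral.integral_const_mul]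
  rw [integral_profileXT ha hε hL, integral_exp_neg_div ha hε hL, cutoffKernel, cutoffRadial]
  simp only [div_div]
  have := Real.pi_ne_zero
  field_simp
  ring

/-- The regularized one-loop weight with one `t₁·∂_x∂_t`-propagator and one
`t₂·∂_x`-propagator has logarithmic singular part
`(δ_{ij}/(64π²)) (∫ φ(x,x) dx) · log ε` as `ε → 0⁺`. -/
theorem log_divergence_xt_x
    (L : ℝ) (hL : 0 < L) (i j : Fin 4)
    (φ : EuclideanSpace ℝ (Fin 4) × EuclideanSpace ℝ (Fin 4) → ℝ)
    (hφ : ContDiff ℝ (⊤ : ℕ∞) φ) (hφc : HasCompactSupport φ) :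
    ∃ c : ℝ, Filter.Tendsto
      (fun ε : ℝ =>
        (∫ p : EuclideanSpace ℝ (Fin 4) × EuclideanSpace ℝ (Fin 4),
          ∫ t₁ in ε..L, ∫ t₂ in ε..L,
            φ p * (t₁ * t₂) * heatKernelDxt i t₁ p.1 p.2 * heatKernelDx j t₂ p.1 p.2) -
        ((if i = j then (1 : ℝ) else 0) / (64 * Real.pi ^ 2)) *
          (∫ x : EuclideanSpace ℝ (Fin 4), φ (x, x)) * Real.log ε)
      (𝓝[>] 0) (𝓝 c) := by
  obtain ⟨A, R, hR, hA, hsupp⟩ :=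
    exists_fibre_integral_bounds (volume : Measure (EuclideanSpace ℝ (Fin 4))) hφ hφc
  have hΦm : Measurable fun z : EuclideanSpace ℝ (Fin 4) =>
      ∫ y : EuclideanSpace ℝ (Fin 4), φ (z + y, y) :=
    (StronglyMeasurable.integral_prod_right (f := fun z y => φ (z + y, y))
      (hφ.continuous.comp (by fun_prop)).stronglyMeasurable).measurable
  obtain ⟨c, hc⟩ := exists_tendsto_integral_mul_cutoffKernel isCutoff_profileXT isCutoff_exp_neg
    hL i j hΦm hR hA hsupp
  refine ⟨_, (hc.const_mul (-(1 / (16 * Real.pi ^ 4)))).congr' ?_⟩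
  filter_upwards [Ioo_mem_nhdsGT hL] with ε hε
  have hφi : Integrable φ ((volume : Measure (EuclideanSpace ℝ (Fin 4))).prod volume) :=
    hφ.continuous.integrable_of_hasCompactSupport hφc
  simp_rw [integral_heatKernel_mul_heatKernel i j hε.1 hε.2.le]
  rw [integral_const_mul, Measure.volume_eq_prod, integral_mul_comp_sub volume hφi
    (measurable_cutoffKernel isCutoff_profileXT isCutoff_exp_neg i j L ε)
    (abs_cutoffKernel_le isCutoff_profileXT isCutoff_exp_neg hL hε.1 i j)]
  simp only [zero_add]
  have := Real.pi_ne_zero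
  field_simp
  ring
end

section
/- For t > 0 and x, y ∈ ℝ⁴, let k_t(x,y) = (4πt)^{−2} exp(−‖x−y‖²/(4t)) be the scalar heat kernel on ℝ⁴. Fix L > 0, indices i, j, m ∈ {1,2,3,4}, and a smooth compactly supported function φ : ℝ⁴ × ℝ⁴ → ℝ. For 0 < ε < L define I(ε) = ∫_{ℝ⁴×ℝ⁴} ∫_{[ε,L]²} φ(x,y) · t₁ t₂ · (∂²k_{t₁}/∂x^m∂x^i)(x,y) (∂k_{t₂}/∂x^j)(x,y) dt₁ dt₂ dx dy. Then I(ε) converges to a finite limit as ε → 0⁺; in particular its logarithmic singular part vanishes identically. -/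
open MeasureTheory Filter Topology

/-- The second spatial derivative `∂²k_t/∂x^m∂x^i` of the scalar heat kernel on `ℝ⁴`. -/
noncomputable def heatKernelDxx (m i : Fin 4) (t : ℝ)
    (x y : EuclideanSpace ℝ (Fin 4)) : ℝ :=
  (1 / (4 * Real.pi) ^ 2) *
    (-(if m = i then (1 : ℝ) else 0) / (2 * t ^ 3) +
      (x m - y m) * (x i - y i) / (4 * t ^ 4)) *
    Real.exp (-‖x - y‖ ^ 2 / (4 * t))

/-- An antiderivative in `t`, on `t > 0` and off the diagonal, of `t * ∂k_t/∂x^j`. -/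
noncomputable def heatDxPrimitive (j : Fin 4) (t : ℝ) (x y : EuclideanSpace ℝ (Fin 4)) : ℝ :=
  -(1 / (4 * Real.pi) ^ 2) * ((x j - y j) / 2) *
    (Real.exp (-(‖x - y‖ ^ 2 / 4 / t)) / (‖x - y‖ ^ 2 / 4))

/-- An antiderivative in `t`, on `t > 0` and off the diagonal, of `t * ∂²k_t/∂x^m∂x^i`. -/
noncomputable def heatDxxPrimitive (m i : Fin 4) (t : ℝ)
    (x y : EuclideanSpace ℝ (Fin 4)) : ℝ :=
  (1 / (4 * Real.pi) ^ 2) *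
    (-(if m = i then (1 : ℝ) else 0) / 2 *
        (Real.exp (-(‖x - y‖ ^ 2 / 4 / t)) / (‖x - y‖ ^ 2 / 4)) +
      (x m - y m) * (x i - y i) / 4 *
        ((1 + ‖x - y‖ ^ 2 / 4 / t) * Real.exp (-(‖x - y‖ ^ 2 / 4 / t)) / (‖x - y‖ ^ 2 / 4) ^ 2))

lemma hasDerivAt_exp_neg_div {a t : ℝ} (ht : t ≠ 0) :
    HasDerivAt (fun s => Real.exp (-(a / s))) (Real.exp (-(a / t)) * (a / t ^ 2)) t := by
  have h : HasDerivAt (fun s => -(a / s)) (-(a * -(t ^ 2)⁻¹)) t :=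
    ((hasDerivAt_inv ht).const_mul a).neg
  convert! h.exp using 1
  field_simp

lemma hasDerivAt_exp_neg_div_div {a t : ℝ} (ha : a ≠ 0) (ht : t ≠ 0) :
    HasDerivAt (fun s => Real.exp (-(a / s)) / a) (Real.exp (-(a / t)) / t ^ 2) t := by
  convert! (hasDerivAt_exp_neg_div (a := a) ht).div_const a using 1
  field_simp

lemma hasDerivAt_one_add_div_mul_exp_neg_div {a t : ℝ} (ha : a ≠ 0) (ht : t ≠ 0) :
    HasDerivAt (fun s => (1 + a / s) * Real.exp (-(a / s)) / a ^ 2)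
      (Real.exp (-(a / t)) / t ^ 3) t := by
  have h1 : HasDerivAt (fun s => 1 + a / s) (a * -(t ^ 2)⁻¹) t :=
    ((hasDerivAt_inv ht).const_mul a).const_add 1
  convert! (h1.mul (hasDerivAt_exp_neg_div (a := a) ht)).div_const (a ^ 2) using 1
  field_simp
  ring

lemma hasDerivAt_heatDxPrimitive (j : Fin 4) {t : ℝ} (ht : t ≠ 0)
    {x y : EuclideanSpace ℝ (Fin 4)} (hxy : x ≠ y) :
    HasDerivAt (fun s => heatDxPrimitive j s x y) (t * heatKernelDx j t x y) t := by
  have ha : ‖x - y‖ ^ 2 / 4 ≠ 0 := by simpa [sub_eq_zero] using hxy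
  convert! (hasDerivAt_exp_neg_div_div ha ht).const_mul
    (-(1 / (4 * Real.pi) ^ 2) * ((x j - y j) / 2)) using 1
  rw [heatKernelDx, neg_div, div_div _ 4 t]
  field_simp

lemma hasDerivAt_heatDxxPrimitive (m i : Fin 4) {t : ℝ} (ht : t ≠ 0)
    {x y : EuclideanSpace ℝ (Fin 4)} (hxy : x ≠ y) :
    HasDerivAt (fun s => heatDxxPrimitive m i s x y) (t * heatKernelDxx m i t x y) t := by
  have ha : ‖x - y‖ ^ 2 / 4 ≠ 0 := by simpa [sub_eq_zero] using hxy
  convert! (((hasDerivAt_exp_neg_div_div ha ht).const_mul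
      (-(if m = i then (1 : ℝ) else 0) / 2)).add
    ((hasDerivAt_one_add_div_mul_exp_neg_div ha ht).const_mul
      ((x m - y m) * (x i - y i) / 4))).const_mul (1 / (4 * Real.pi) ^ 2) using 1
  rw [heatKernelDxx, neg_div (4 * t), div_div _ 4 t]
  field_simp

lemma heatDxPrimitive_self (j : Fin 4) (t : ℝ) (x : EuclideanSpace ℝ (Fin 4)) :
    heatDxPrimitive j t x x = 0 := by
  simp [heatDxPrimitive]

lemma heatKernelDx_self (j : Fin 4) (t : ℝ) (x : EuclideanSpace ℝ (Fin 4)) :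
    heatKernelDx j t x x = 0 := by
  simp [heatKernelDx]

lemma ne_zero_of_mem_uIcc {a b t : ℝ} (ha : 0 < a) (hb : 0 < b) (ht : t ∈ Set.uIcc a b) :
    t ≠ 0 :=
  ((lt_min ha hb).trans_le ht.1).ne'

lemma integral_mul_heatKernelDx (j : Fin 4) {ε L : ℝ} (hε : 0 < ε) (hL : 0 < L)
    {x y : EuclideanSpace ℝ (Fin 4)} (hxy : x ≠ y) :
    ∫ t in ε..L, t * heatKernelDx j t x y =
      heatDxPrimitive j L x y - heatDxPrimitive j ε x y := by
  refine intervalIntegral.integral_eq_sub_of_hasDerivAt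
    (fun t ht => hasDerivAt_heatDxPrimitive j (ne_zero_of_mem_uIcc hε hL ht) hxy)
    (ContinuousOn.intervalIntegrable fun t ht => ContinuousAt.continuousWithinAt ?_)
  have := ne_zero_of_mem_uIcc hε hL ht
  unfold heatKernelDx
  fun_prop (disch := positivity)

lemma integral_mul_heatKernelDxx (m i : Fin 4) {ε L : ℝ} (hε : 0 < ε) (hL : 0 < L)
    {x y : EuclideanSpace ℝ (Fin 4)} (hxy : x ≠ y) :
    ∫ t in ε..L, t * heatKernelDxx m i t x y =
      heatDxxPrimitive m i L x y - heatDxxPrimitive m i ε x y := by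
  refine intervalIntegral.integral_eq_sub_of_hasDerivAt
    (fun t ht => hasDerivAt_heatDxxPrimitive m i (ne_zero_of_mem_uIcc hε hL ht) hxy)
    (ContinuousOn.intervalIntegrable fun t ht => ContinuousAt.continuousWithinAt ?_)
  have := ne_zero_of_mem_uIcc hε hL ht
  unfold heatKernelDxx
  fun_prop (disch := positivity)

lemma integral_integral_heatKernelDxx_mul_heatKernelDx (i j m : Fin 4) (c : ℝ) {ε L : ℝ}
    (hε : 0 < ε) (hL : 0 < L) (x y : EuclideanSpace ℝ (Fin 4)) :
    ∫ t₁ in ε..L, ∫ t₂ in ε..L,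
        c * (t₁ * t₂) * heatKernelDxx m i t₁ x y * heatKernelDx j t₂ x y =
      c * (heatDxxPrimitive m i L x y - heatDxxPrimitive m i ε x y) *
        (heatDxPrimitive j L x y - heatDxPrimitive j ε x y) := by
  rcases eq_or_ne x y with rfl | hxy
  · simp [heatDxPrimitive_self, heatKernelDx_self]
  have h (t₁ t₂ : ℝ) : c * (t₁ * t₂) * heatKernelDxx m i t₁ x y * heatKernelDx j t₂ x y =
      c * (t₁ * heatKernelDxx m i t₁ x y) * (t₂ * heatKernelDx j t₂ x y) := by ring
  simp_rw [h, intervalIntegral.integral_const_mul, intervalIntegral.integral_mul_const,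
    intervalIntegral.integral_const_mul, integral_mul_heatKernelDx j hε hL hxy,
    integral_mul_heatKernelDxx m i hε hL hxy]

lemma abs_coord_sub_le (k : Fin 4) (x y : EuclideanSpace ℝ (Fin 4)) :
    |x k - y k| ≤ ‖x - y‖ :=
  PiLp.norm_apply_le (x - y) k

lemma abs_heatDxPrimitive_le (j : Fin 4) {t : ℝ} (ht : 0 < t)
    (x y : EuclideanSpace ℝ (Fin 4)) :
    |heatDxPrimitive j t x y| ≤ 1 / (4 * Real.pi) ^ 2 * (2 * ‖x - y‖⁻¹) := by
  have he : Real.exp (-(‖x - y‖ ^ 2 / 4 / t)) ≤ 1 := Real.exp_le_one_iff.2 (by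
    rw [neg_nonpos]; positivity)
  rw [heatDxPrimitive, abs_mul, abs_mul, abs_neg, abs_of_nonneg (a := 1 / (4 * Real.pi) ^ 2)
    (by positivity), abs_div, abs_of_nonneg (a := _ / (‖x - y‖ ^ 2 / 4)) (by positivity),
    abs_two, mul_assoc]
  refine mul_le_mul_of_nonneg_left ?_ (by positivity)
  calc |x j - y j| / 2 * (Real.exp (-(‖x - y‖ ^ 2 / 4 / t)) / (‖x - y‖ ^ 2 / 4))
      ≤ ‖x - y‖ / 2 * (1 / (‖x - y‖ ^ 2 / 4)) := by
        gcongr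
        exact abs_coord_sub_le j x y
    _ = 2 * ‖x - y‖⁻¹ := by
        rcases eq_or_ne ‖x - y‖ 0 with h | h
        · simp [h]
        · field_simp
          norm_num

lemma abs_heatDxxPrimitive_le (m i : Fin 4) {t : ℝ} (ht : 0 < t)
    (x y : EuclideanSpace ℝ (Fin 4)) :
    |heatDxxPrimitive m i t x y| ≤ 1 / (4 * Real.pi) ^ 2 * (6 * (‖x - y‖ ^ 2)⁻¹) := by
  have ha : 0 ≤ ‖x - y‖ ^ 2 / 4 / t := by positivity
  have he : Real.exp (-(‖x - y‖ ^ 2 / 4 / t)) ≤ 1 := Real.exp_le_one_iff.2 (by linarith)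
  have he' : (1 + ‖x - y‖ ^ 2 / 4 / t) * Real.exp (-(‖x - y‖ ^ 2 / 4 / t)) ≤ 1 := by
    rw [Real.exp_neg, ← div_eq_mul_inv, div_le_one (Real.exp_pos _), add_comm]
    exact Real.add_one_le_exp _
  have hδ : |-(if m = i then (1 : ℝ) else 0)| ≤ 1 := by split_ifs <;> simp
  rw [heatDxxPrimitive, abs_mul, abs_of_nonneg (a := 1 / (4 * Real.pi) ^ 2) (by positivity)]
  gcongr
  refine (abs_add_le _ _).trans ?_
  rw [abs_mul, abs_mul, abs_div _ (2 : ℝ), abs_div _ (4 : ℝ), abs_mul (x m - y m), abs_two,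
    abs_of_nonneg (a := (4 : ℝ)) (by norm_num),
    abs_of_nonneg (a := _ / (‖x - y‖ ^ 2 / 4)) (by positivity),
    abs_of_nonneg (a := _ / (‖x - y‖ ^ 2 / 4) ^ 2) (by positivity)]
  calc _ ≤ 1 / 2 * (1 / (‖x - y‖ ^ 2 / 4)) +
        ‖x - y‖ * ‖x - y‖ / 4 * (1 / (‖x - y‖ ^ 2 / 4) ^ 2) := by
        gcongr
        · exact abs_coord_sub_le m x y
        · exact abs_coord_sub_le i x y
    _ = 6 * (‖x - y‖ ^ 2)⁻¹ := by
        rcases eq_or_ne ‖x - y‖ 0 with h | h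
        · simp [h]
        · field_simp
          norm_num

lemma tendsto_div_nhdsGT_zero_atTop {a : ℝ} (ha : 0 < a) :
    Tendsto (fun t => a / t) (𝓝[>] 0) atTop :=
  tendsto_inv_nhdsGT_zero.const_mul_atTop ha

lemma tendsto_exp_neg_div_nhdsGT_zero {a : ℝ} (ha : 0 < a) :
    Tendsto (fun t => Real.exp (-(a / t))) (𝓝[>] 0) (𝓝 0) :=
  Real.tendsto_exp_neg_atTop_nhds_zero.comp (tendsto_div_nhdsGT_zero_atTop ha)

lemma tendsto_one_add_div_mul_exp_neg_div_nhdsGT_zero {a : ℝ} (ha : 0 < a) :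
    Tendsto (fun t => (1 + a / t) * Real.exp (-(a / t))) (𝓝[>] 0) (𝓝 0) := by
  have h := (tendsto_exp_neg_div_nhdsGT_zero ha).add
    ((Real.tendsto_pow_mul_exp_neg_atTop_nhds_zero 1).comp (tendsto_div_nhdsGT_zero_atTop ha))
  rw [add_zero] at h
  refine h.congr fun t => ?_
  simp only [Function.comp_apply]
  ring

lemma tendsto_heatDxPrimitive_nhdsGT_zero (j : Fin 4) (x y : EuclideanSpace ℝ (Fin 4)) :
    Tendsto (fun t => heatDxPrimitive j t x y) (𝓝[>] 0) (𝓝 0) := by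
  rcases eq_or_ne x y with rfl | hxy
  · simp [heatDxPrimitive_self]
  have ha : 0 < ‖x - y‖ ^ 2 / 4 := by have := norm_sub_pos_iff.2 hxy; positivity
  have h := ((tendsto_exp_neg_div_nhdsGT_zero ha).div_const (‖x - y‖ ^ 2 / 4)).const_mul
    (-(1 / (4 * Real.pi) ^ 2) * ((x j - y j) / 2))
  rwa [zero_div, mul_zero] at h

lemma tendsto_heatDxxPrimitive_nhdsGT_zero (m i : Fin 4) {x y : EuclideanSpace ℝ (Fin 4)}
    (hxy : x ≠ y) : Tendsto (fun t => heatDxxPrimitive m i t x y) (𝓝[>] 0) (𝓝 0) := by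
  have ha : 0 < ‖x - y‖ ^ 2 / 4 := by have := norm_sub_pos_iff.2 hxy; positivity
  have h := ((((tendsto_exp_neg_div_nhdsGT_zero ha).div_const (‖x - y‖ ^ 2 / 4)).const_mul
      (-(if m = i then (1 : ℝ) else 0) / 2)).add
    (((tendsto_one_add_div_mul_exp_neg_div_nhdsGT_zero ha).div_const
      ((‖x - y‖ ^ 2 / 4) ^ 2)).const_mul
        ((x m - y m) * (x i - y i) / 4))).const_mul (1 / (4 * Real.pi) ^ 2)
  simp only [zero_div, mul_zero, add_zero] at h
  exact h

lemma tendsto_heatPrimitive_mul (i j m : Fin 4) (c L : ℝ) (x y : EuclideanSpace ℝ (Fin 4)) :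
    Tendsto (fun ε => c * (heatDxxPrimitive m i L x y - heatDxxPrimitive m i ε x y) *
        (heatDxPrimitive j L x y - heatDxPrimitive j ε x y)) (𝓝[>] 0)
      (𝓝 (c * heatDxxPrimitive m i L x y * heatDxPrimitive j L x y)) := by
  rcases eq_or_ne x y with rfl | hxy
  · simp [heatDxPrimitive_self]
  simpa using (((tendsto_heatDxxPrimitive_nhdsGT_zero m i hxy).const_sub
    (heatDxxPrimitive m i L x y)).const_mul c).mul
      ((tendsto_heatDxPrimitive_nhdsGT_zero j x y).const_sub (heatDxPrimitive j L x y))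

lemma measurable_heatDxPrimitive (j : Fin 4) (t : ℝ) :
    Measurable fun p : EuclideanSpace ℝ (Fin 4) × EuclideanSpace ℝ (Fin 4) =>
      heatDxPrimitive j t p.1 p.2 := by
  unfold heatDxPrimitive
  fun_prop

lemma measurable_heatDxxPrimitive (m i : Fin 4) (t : ℝ) :
    Measurable fun p : EuclideanSpace ℝ (Fin 4) × EuclideanSpace ℝ (Fin 4) =>
      heatDxxPrimitive m i t p.1 p.2 := by
  unfold heatDxxPrimitive
  fun_prop

/-- A continuous compactly supported function on `E × E` stays integrable after multiplication
by a locally integrable function of the difference of the two variables. -/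
lemma integrable_mul_comp_sub {E : Type*} [NormedAddCommGroup E] [MeasurableSpace E]
    [BorelSpace E] [SecondCountableTopology E] {μ : Measure E} [SFinite μ]
    [IsFiniteMeasureOnCompacts μ] [μ.IsAddRightInvariant]
    {φ : E × E → ℝ} (hφ : Continuous φ) (hφc : HasCompactSupport φ)
    {g : E → ℝ} (hg : LocallyIntegrable g μ) :
    Integrable (fun p : E × E => φ p * g (p.1 - p.2)) (μ.prod μ) := by
  set K : Set E := Prod.snd '' tsupport φ
  set D : Set E := (fun p : E × E => p.1 - p.2) '' tsupport φ
  have hK : IsCompact K := hφc.isCompact.image continuous_snd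
  have hD : IsCompact D := hφc.isCompact.image (continuous_fst.sub continuous_snd)
  have hK1 : Integrable (K.indicator fun _ => (1 : ℝ)) μ :=
    (integrable_indicator_iff hK.measurableSet).2 (integrableOn_const hK.measure_lt_top.ne)
  have hD1 : Integrable (D.indicator g) μ :=
    (integrable_indicator_iff hD.measurableSet).2 (hg.integrableOn_isCompact hD)
  obtain ⟨C, hC⟩ := hφc.exists_bound_of_continuous hφ
  refine ((hK1.convolution_integrand (ContinuousLinearMap.mul ℝ ℝ) hD1).bdd_mul
    hφ.aestronglyMeasurable (ae_of_all _ hC)).congr (ae_of_all _ fun p => ?_)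
  by_cases hp : p ∈ tsupport φ
  · have h1 : p.2 ∈ K := Set.mem_image_of_mem _ hp
    have h2 : p.1 - p.2 ∈ D := Set.mem_image_of_mem (fun p : E × E => p.1 - p.2) hp
    simp [h1, h2]
  · simp [image_eq_zero_of_notMem_tsupport hp]

lemma locallyIntegrable_inv_norm_pow_three :
    LocallyIntegrable fun z : EuclideanSpace ℝ (Fin 4) => (‖z‖ ^ 3)⁻¹ := by
  refine locallyIntegrable_of_norm_le_rpow (C := 1) (α := 3) (by simp) (by simp; norm_num)
    (ae_of_all _ fun z => ?_) (Measurable.aestronglyMeasurable (by fun_prop))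
  rw [Real.rpow_neg (norm_nonneg z), one_mul, Real.norm_of_nonneg (by positivity)]
  norm_cast

/-- The regularized one-loop weight with one `t₁·∂_x∂_x`-propagator and one
`t₂·∂_x`-propagator converges as `ε → 0⁺`: its logarithmic singular part vanishes. -/
theorem log_divergence_xxx2_vanishes
    (L : ℝ) (hL : 0 < L) (i j m : Fin 4)
    (φ : EuclideanSpace ℝ (Fin 4) × EuclideanSpace ℝ (Fin 4) → ℝ)
    (hφ : ContDiff ℝ (⊤ : ℕ∞) φ) (hφc : HasCompactSupport φ) :
    ∃ c : ℝ, Filter.Tendsto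
      (fun ε : ℝ =>
        ∫ p : EuclideanSpace ℝ (Fin 4) × EuclideanSpace ℝ (Fin 4),
          ∫ t₁ in ε..L, ∫ t₂ in ε..L,
            φ p * (t₁ * t₂) * heatKernelDxx m i t₁ p.1 p.2 * heatKernelDx j t₂ p.1 p.2)
      (𝓝[>] 0) (𝓝 c) := by
  set G : ℝ → EuclideanSpace ℝ (Fin 4) × EuclideanSpace ℝ (Fin 4) → ℝ := fun ε p =>
    φ p * (heatDxxPrimitive m i L p.1 p.2 - heatDxxPrimitive m i ε p.1 p.2) *
      (heatDxPrimitive j L p.1 p.2 - heatDxPrimitive j ε p.1 p.2) with hG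
  set c : ℝ := 1 / (4 * Real.pi) ^ 2 with hc
  refine ⟨∫ p : EuclideanSpace ℝ (Fin 4) × EuclideanSpace ℝ (Fin 4),
    φ p * heatDxxPrimitive m i L p.1 p.2 * heatDxPrimitive j L p.1 p.2, ?_⟩
  have hint : Integrable fun p : EuclideanSpace ℝ (Fin 4) × EuclideanSpace ℝ (Fin 4) =>
      48 * c ^ 2 * (‖φ p‖ * (‖p.1 - p.2‖ ^ 3)⁻¹) :=
    (integrable_mul_comp_sub hφ.continuous.norm hφc.norm
      locallyIntegrable_inv_norm_pow_three).const_mul _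
  have hlim : Tendsto (fun ε => ∫ p, G ε p) (𝓝[>] 0)
      (𝓝 (∫ p, φ p * heatDxxPrimitive m i L p.1 p.2 * heatDxPrimitive j L p.1 p.2)) := by
    refine tendsto_integral_filter_of_dominated_convergence _
      (Eventually.of_forall fun ε => ?_) ?_ hint
      (ae_of_all _ fun p => tendsto_heatPrimitive_mul i j m (φ p) L p.1 p.2)
    · exact (((hφ.continuous.measurable.mul ((measurable_heatDxxPrimitive m i L).sub
        (measurable_heatDxxPrimitive m i ε))).mul ((measurable_heatDxPrimitive j L).sub
          (measurable_heatDxPrimitive j ε)))).aestronglyMeasurable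
    · filter_upwards [self_mem_nhdsWithin] with ε hε
      refine ae_of_all _ fun p => ?_
      have hA := (abs_sub _ _).trans (add_le_add (abs_heatDxxPrimitive_le m i hL p.1 p.2)
        (abs_heatDxxPrimitive_le m i hε p.1 p.2))
      have hB := (abs_sub _ _).trans (add_le_add (abs_heatDxPrimitive_le j hL p.1 p.2)
        (abs_heatDxPrimitive_le j hε p.1 p.2))
      rw [← hc] at hA hB
      simp only [hG, norm_mul, Real.norm_eq_abs]
      calc _ ≤ |φ p| * (c * (6 * (‖p.1 - p.2‖ ^ 2)⁻¹) + c * (6 * (‖p.1 - p.2‖ ^ 2)⁻¹)) *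
            (c * (2 * ‖p.1 - p.2‖⁻¹) + c * (2 * ‖p.1 - p.2‖⁻¹)) := by gcongr
        _ = _ := by ring
  refine hlim.congr' ?_
  filter_upwards [self_mem_nhdsWithin] with ε hε
  exact integral_congr_ae (ae_of_all _ fun p =>
    (integral_integral_heatKernelDxx_mul_heatKernelDx i j m (φ p) hε hL p.1 p.2).symm)
end
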